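/- Let d ≥ 1 and let ξ, η ∈ ℝ^d with η ≠ 0 and ξ − η ≠ 0. If ∇H(η) + ∇H(ξ−η) = 0, where ∇H(x) = H'(|x|)·x/|x|, then ξ = 0. Conversely, if ξ = 0 (and η ≠ 0) then ∇H(η) + ∇H(−η) = 0 and H(ξ) − H(η) + H(ξ−η) = 0. Hence for the phase Ω₋₊(ξ,η) = H(ξ) − H(η) + H(ξ−η), the space-resonant set and the space-time resonant set both equal {ξ = 0}. -/

import Mathlib

/-- The dispersion relation `H(ξ) = |ξ|√(2+|ξ|²)`. -/
noncomputable def H {d : ℕ} (x : EuclideanSpace ℝ (Fin d)) : ℝ :=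
  ‖x‖ * Real.sqrt (2 + ‖x‖ ^ 2)

/-- The gradient `∇H(x) = H'(|x|)·x/|x|` with `H'(r) = (2+2r²)/√(2+r²)`. -/
noncomputable def gradH {d : ℕ} (x : EuclideanSpace ℝ (Fin d)) : EuclideanSpace ℝ (Fin d) :=
  ((2 + 2 * ‖x‖ ^ 2) / Real.sqrt (2 + ‖x‖ ^ 2) / ‖x‖) • x

/-- The norm of `∇H(x)` is `H'(|x|)`. -/
theorem norm_gradH {d : ℕ} {x : EuclideanSpace ℝ (Fin d)} (hx : x ≠ 0) :
    ‖gradH x‖ = (2 + 2 * ‖x‖ ^ 2) / Real.sqrt (2 + ‖x‖ ^ 2) := by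
  have hx' : ‖x‖ ≠ 0 := norm_ne_zero_iff.mpr hx
  rw [gradH, norm_smul, Real.norm_of_nonneg (by positivity), div_mul_cancel₀ _ hx']

/-- The radial derivative `H'(r) = (2+2r²)/√(2+r²)` is injective on `r ≥ 0`. -/
theorem radialDeriv_injOn :
    Set.InjOn (fun r : ℝ => (2 + 2 * r ^ 2) / Real.sqrt (2 + r ^ 2)) (Set.Ici 0) := by
  intro r hr s hs h
  have h2 := congrArg (fun t : ℝ => t ^ 2) h
  simp only [div_pow] at h2
  rw [Real.sq_sqrt (by positivity), Real.sq_sqrt (by positivity),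
    div_eq_div_iff (by positivity) (by positivity)] at h2
  have hfactor : (r ^ 2 - s ^ 2) * (3 + 2 * (r ^ 2 + s ^ 2) + r ^ 2 * s ^ 2) = 0 := by
    linarith
  have hpos : 3 + 2 * (r ^ 2 + s ^ 2) + r ^ 2 * s ^ 2 ≠ 0 := by positivity
  have hsq : r ^ 2 = s ^ 2 := sub_eq_zero.mp ((mul_eq_zero.mp hfactor).resolve_right hpos)
  exact (pow_left_inj₀ hr hs two_ne_zero).mp hsq

/-- Nonzero vectors with opposite gradients of `H` have the same norm. -/
theorem norm_eq_of_gradH_add_eq_zero {d : ℕ} {x y : EuclideanSpace ℝ (Fin d)}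
    (hx : x ≠ 0) (hy : y ≠ 0) (h : gradH x + gradH y = 0) : ‖x‖ = ‖y‖ := by
  apply radialDeriv_injOn (norm_nonneg x) (norm_nonneg y)
  simp only [← norm_gradH hx, ← norm_gradH hy, eq_neg_of_add_eq_zero_left h, norm_neg]

/-- If `∇H(η) + ∇H(ξ−η) = 0` (with `η ≠ 0`, `ξ−η ≠ 0`) then `ξ = 0`; conversely if `ξ = 0`
and `η ≠ 0` then `∇H(η) + ∇H(−η) = 0` and `H(ξ) − H(η) + H(ξ−η) = 0`.  Hence for the phase
`Ω₋₊(ξ,η) = H(ξ) − H(η) + H(ξ−η)` the space-resonant and space-time resonant sets both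
equal `{ξ = 0}`. -/
theorem space_time_resonant_set_minus_plus (d : ℕ) (hd : 1 ≤ d) :
    (∀ ξ η : EuclideanSpace ℝ (Fin d), η ≠ 0 → ξ - η ≠ 0 →
      gradH η + gradH (ξ - η) = 0 → ξ = 0) ∧
    (∀ η : EuclideanSpace ℝ (Fin d), η ≠ 0 →
      gradH η + gradH (-η) = 0 ∧
      H (0 : EuclideanSpace ℝ (Fin d)) - H η + H ((0 : EuclideanSpace ℝ (Fin d)) - η) = 0) := by
  refine ⟨fun ξ η hη hξη h => ?_, fun η _ => ⟨by simp [gradH], by simp [H]⟩⟩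
  have hnorm := norm_eq_of_gradH_add_eq_zero hη hξη h
  have hpos : 0 < ‖η‖ := norm_pos_iff.mpr hη
  rw [gradH, gradH, ← hnorm, ← smul_add, add_sub_cancel] at h
  exact (smul_eq_zero.mp h).resolve_left (by positivity)
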